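/- Let F be a free group of finite rank N ≥ 2. The canonical homomorphism Out(F) → Out(F̂) induced by the profinite completion map Aut(F) → Aut(F̂) is injective; that is, if φ ∈ Aut(F) is such that its extension φ̂ to the profinite completion F̂ is an inner automorphism of F̂, then φ is an inner automorphism of F. -/

import Mathlib

/-- The index type of finite-index normal subgroups of `G`. -/
def FinIdxNormal (G : Type*) [Group G] : Type _ :=
  {N : Subgroup G // N.Normal ∧ N.FiniteIndex}

instance {G : Type*} [Group G] (N : FinIdxNormal G) : N.val.Normal := N.prop.1

/-- The transition map `G ⧸ N → G ⧸ M` for `N ≤ M`. -/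
def qmap {G : Type*} [Group G] {N M : FinIdxNormal G} (h : N.val ≤ M.val) :
    G ⧸ N.val →* G ⧸ M.val :=
  QuotientGroup.map _ _ (MonoidHom.id G) (by rwa [Subgroup.comap_id])

/-- The profinite completion of `G`, realised as the subgroup of compatible families
in the product of the finite quotients of `G`. -/
def profComp (G : Type*) [Group G] : Subgroup (∀ N : FinIdxNormal G, G ⧸ N.val) where
  carrier := {x | ∀ (N M : FinIdxNormal G) (h : N.val ≤ M.val), qmap h (x N) = x M}
  one_mem' := by intro N M h; simp
  mul_mem' := by
    intro a b ha hb N M h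
    simp only [Pi.mul_apply, map_mul, ha N M h, hb N M h]
  inv_mem' := by
    intro a ha N M h
    simp only [Pi.inv_apply, map_inv, ha N M h]

/-- The canonical homomorphism from `G` to its profinite completion. -/
def iotaHom (G : Type*) [Group G] : G →* profComp G where
  toFun g := ⟨fun _ => QuotientGroup.mk g, by
    intro N M h
    simp [qmap]⟩
  map_one' := by
    apply Subtype.ext
    funext N
    simp
  map_mul' a b := by
    apply Subtype.ext
    funext N
    simp

open Equiv Function

/-- Two elements are finitely conjugate if their images in every finite quotient are conjugate. -/
def IsFinitelyConj {G : Type*} [Group G] (u v : G) : Prop :=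
  ∀ N : FinIdxNormal G, IsConj (u : G ⧸ N.val) (v : G ⧸ N.val)

namespace IsFinitelyConj

variable {G : Type*} [Group G] {u v w : G}

theorem map_of_finite (h : IsFinitelyConj u v) {H : Type*} [Group H] [Finite H] (ρ : G →* H) :
    IsConj (ρ u) (ρ v) := by
  obtain ⟨c, hc⟩ := isConj_iff.1 (h ⟨ρ.ker, inferInstance, Subgroup.finiteIndex_ker ρ⟩)
  obtain ⟨c, rfl⟩ := QuotientGroup.mk_surjective c
  refine isConj_iff.2 ⟨ρ c, ?_⟩
  rw [← QuotientGroup.mk_inv, ← QuotientGroup.mk_mul, ← QuotientGroup.mk_mul,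
    QuotientGroup.eq, MonoidHom.mem_ker, map_mul, map_inv, inv_mul_eq_one] at hc
  simpa using hc

theorem of_isConj (h : IsConj u v) : IsFinitelyConj u v := fun N =>
  (QuotientGroup.mk' N.val).map_isConj h

theorem trans (h : IsFinitelyConj u v) (h' : IsFinitelyConj v w) : IsFinitelyConj u w :=
  fun N => (h N).trans (h' N)

theorem exists_fixed_point (h : IsFinitelyConj u v) {Y : Type*} [Finite Y] (ρ : G →* Perm Y)
    (hu : ∃ y, ρ u y = y) : ∃ y, ρ v y = y := by
  obtain ⟨c, hc⟩ := isConj_iff.1 (h.map_of_finite ρ)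
  obtain ⟨y, hy⟩ := hu
  exact ⟨c y, by simp [← hc, hy]⟩

end IsFinitelyConj

namespace FreeGroup

universe u

variable {α : Type u}

/-- Partial injections indexed by `α` on a finite set `X` extend to permutations of the disjoint
union of copies of `X` indexed by `α → Bool`, where the generator `a` either follows its partial
injection, forwards or backwards, or flips the coordinate `a` of the index. -/
theorem exists_perm_extension [Finite α] {X : Type u} [Finite X] (R : α → X → X → Prop)
    (hf : ∀ a x y z, R a x y → R a x z → y = z) (hi : ∀ a x y z, R a x z → R a y z → x = y) :
    ∃ ρ : FreeGroup α →* Perm (X × (α → Bool)),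
      (∀ a x y, R a x y → ρ (of a) (x, fun _ => false) = (y, fun _ => false)) ∧
      ∀ a x s y t, ρ (of a) (x, s) = (y, t) →
        (t = s ∧ (R a x y ∨ R a y x)) ∨ (y = x ∧ t a = !s a ∧ ∀ b, b ≠ a → t b = s b) := by
  classical
  have key : ∀ a, ∃ σ : Perm (X × (α → Bool)),
      (∀ x y, R a x y → σ (x, fun _ => false) = (y, fun _ => false)) ∧
      ∀ x s y t, σ (x, s) = (y, t) →
        (t = s ∧ (R a x y ∨ R a y x)) ∨ (y = x ∧ t a = !s a ∧ ∀ b, b ≠ a → t b = s b) := by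
    intro a
    let S : Bool → X → X → Prop := fun e x y => if e then R a y x else R a x y
    have hSf : ∀ e x y z, S e x y → S e x z → y = z := by
      rintro (_ | _) x y z h h' <;> simp only [S] at h h'
      exacts [hf a x y z h h', hi a y z x h h']
    have hSn : ∀ e x y, S (!e) x y ↔ S e y x := by
      rintro (_ | _) x y <;> simp [S]
    let T : X × (α → Bool) → X × (α → Bool) := fun p =>
      if h : ∃ y, S (p.2 a) p.1 y then (h.choose, p.2) else (p.1, update p.2 a (!p.2 a))
    have hT1 : ∀ x s y, S (s a) x y → T (x, s) = (y, s) := by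
      intro x s y h
      have h' : ∃ y, S (s a) x y := ⟨y, h⟩
      simp only [T, dif_pos h']
      rw [hSf _ _ _ _ h'.choose_spec h]
    have hT2 : ∀ x s, (¬ ∃ y, S (s a) x y) → T (x, s) = (x, update s a (!s a)) := by
      intro x s h
      simp only [T, dif_neg h]
    have hinj : Injective T := by
      rintro ⟨x, s⟩ ⟨x', s'⟩ h
      by_cases h1 : ∃ y, S (s a) x y <;> by_cases h2 : ∃ y, S (s' a) x' y
      · obtain ⟨y, hy⟩ := h1
        obtain ⟨y', hy'⟩ := h2
        rw [hT1 _ _ _ hy, hT1 _ _ _ hy'] at h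
        obtain ⟨rfl, rfl⟩ := Prod.mk.inj h
        rw [hSf _ _ _ _ ((hSn _ _ _).2 hy) ((hSn _ _ _).2 hy')]
      · obtain ⟨y, hy⟩ := h1
        rw [hT1 _ _ _ hy, hT2 _ _ h2] at h
        obtain ⟨rfl, rfl⟩ := Prod.mk.inj h
        rw [update_self, hSn] at hy
        exact (h2 ⟨_, hy⟩).elim
      · obtain ⟨y, hy⟩ := h2
        rw [hT1 _ _ _ hy, hT2 _ _ h1] at h
        obtain ⟨rfl, rfl⟩ := Prod.mk.inj h
        rw [update_self, hSn] at hy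
        exact (h1 ⟨_, hy⟩).elim
      · rw [hT2 _ _ h1, hT2 _ _ h2] at h
        obtain ⟨rfl, hu⟩ := Prod.mk.inj h
        have : s = s' := by
          funext b
          have hb := congrFun hu b
          by_cases hba : b = a
          · subst hba; simpa using hb
          · simpa [hba] using hb
        rw [this]
    refine ⟨Equiv.ofBijective T (Finite.injective_iff_bijective.1 hinj), ?_, ?_⟩
    · intro x y h
      exact hT1 x _ y (by simpa [S] using h)
    · intro x s y t h
      rw [Equiv.ofBijective_apply] at h
      by_cases h1 : ∃ y, S (s a) x y
      · obtain ⟨y', hy⟩ := h1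
        rw [hT1 _ _ _ hy] at h
        obtain ⟨rfl, rfl⟩ := Prod.mk.inj h
        refine Or.inl ⟨rfl, ?_⟩
        cases hs : s a <;> simp only [S, hs] at hy
        exacts [Or.inl hy, Or.inr hy]
      · rw [hT2 _ _ h1] at h
        obtain ⟨rfl, rfl⟩ := Prod.mk.inj h
        exact Or.inr ⟨rfl, by simp, fun b hb => by simp [hb]⟩
  choose σ h1 h2 using key
  refine ⟨lift σ, ?_, ?_⟩
  · intro a; rw [lift_apply_of]; exact h1 a
  · intro a; rw [lift_apply_of]; exact h2 a

/-- A finite permutation representation, obtained from the cycle labelled by a cyclically reduced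
word, in which that word has a fixed point but shorter words have none. -/
theorem IsCyclicallyReduced.exists_perm_rep [Finite α] {L : List (α × Bool)}
    (hL : IsCyclicallyReduced L) (hne : L ≠ []) :
    ∃ (Y : Type u) (_ : Finite Y) (ρ : FreeGroup α →* Perm Y), (∃ y, ρ (mk L) y = y) ∧
      (2 ≤ L.length → ∀ a y, ρ (of a) y ≠ y) ∧
      (3 ≤ L.length → ∀ a b, a ≠ b → ∀ y, ρ (of a * of b) y ≠ y) := by
  obtain ⟨m, hm⟩ : ∃ m, m = L.length := ⟨_, rfl⟩
  have hm0 : 0 < m := hm ▸ List.length_pos_iff.2 hne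
  have : NeZero m := ⟨hm0.ne'⟩
  let l : ZMod m → α × Bool := fun i => L[i.val]'(hm ▸ ZMod.val_lt i)
  have hl : ∀ (i : ℕ) (hi : i < L.length), l i = L[i] := by
    intro i hi
    simp only [l, ZMod.val_natCast_of_lt (hm ▸ hi : i < m)]
  have hcyc : ∀ i, (l i).1 = (l (i + 1)).1 → (l i).2 = (l (i + 1)).2 := by
    intro i
    obtain ⟨k, hk, rfl⟩ : ∃ k : ℕ, k < m ∧ (k : ZMod m) = i :=
      ⟨i.val, ZMod.val_lt i, ZMod.natCast_zmod_val i⟩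
    by_cases hk1 : k + 1 < m
    · have := List.isChain_iff_getElem.1 hL.1 k (hm ▸ hk1)
      rw [hl k (hm ▸ hk), ← Nat.cast_succ, hl (k + 1) (hm ▸ hk1)]
      exact this
    · have hkm : k + 1 = m := by omega
      have h0 : ((k : ZMod m) + 1) = (0 : ℕ) := by
        rw [← Nat.cast_succ, Nat.succ_eq_add_one, hkm]; simp
      rw [h0, hl k (hm ▸ hk), hl 0 (hm ▸ hm0)]
      refine hL.2 _ ?_ _ ?_
      · rw [List.getLast?_eq_getElem?, Option.mem_def, List.getElem?_eq_some_iff]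
        exact ⟨by omega, by congr 1; omega⟩
      · rw [List.head?_eq_getElem?, Option.mem_def, List.getElem?_eq_some_iff]
        exact ⟨by omega, rfl⟩
  let R : α → ULift.{u} (ZMod m) → ULift.{u} (ZMod m) → Prop := fun a p q =>
    (l p.down = (a, false) ∧ q.down = p.down + 1) ∨ (l q.down = (a, true) ∧ p.down = q.down + 1)
  obtain ⟨ρ, h1, h2⟩ := exists_perm_extension R
    (by
      rintro a ⟨x⟩ ⟨y⟩ ⟨z⟩ h h'
      simp only [R] at h h'
      congr 1
      rcases h with ⟨h, rfl⟩ | ⟨h, rfl⟩ <;> rcases h' with ⟨h', e⟩ | ⟨h', e⟩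
      · exact e.symm
      · subst e; have := hcyc z; simp [h, h'] at this
      · subst e; have := hcyc y; simp [h, h'] at this
      · exact add_right_cancel e)
    (by
      rintro a ⟨x⟩ ⟨y⟩ ⟨z⟩ h h'
      simp only [R] at h h'
      congr 1
      rcases h with ⟨h, rfl⟩ | ⟨h, rfl⟩ <;> rcases h' with ⟨h', e⟩ | ⟨h', e⟩
      · exact add_right_cancel e
      · subst e; have := hcyc x; simp [h, h'] at this
      · subst e; have := hcyc y; simp [h, h'] at this
      · exact e.symm)
  have hR : ∀ a p q, R a p q ∨ R a q p →
      ((l p.down).1 = a ∧ q.down = p.down + 1) ∨ ((l q.down).1 = a ∧ p.down = q.down + 1) := by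
    rintro a p q ((⟨h, e⟩ | ⟨h, e⟩) | (⟨h, e⟩ | ⟨h, e⟩)) <;> simp [h, e]
  refine ⟨_, inferInstance, ρ, ⟨(⟨0⟩, fun _ => false), ?_⟩, ?_, ?_⟩
  · have step : ∀ i : ℕ, i ≤ m →
        ρ (mk (L.drop i)) (⟨0⟩, fun _ => false) = (⟨(i : ZMod m)⟩, fun _ => false) := by
      intro i hi
      induction hi using Nat.decreasingInduction with
      | self => subst hm; simp [← one_eq_mk]
      | of_succ k hk ih =>
        have hk' : k < L.length := hm ▸ hk
        have hlk := hl k hk'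
        rw [List.drop_eq_getElem_cons hk', ← List.singleton_append, ← mul_mk, _root_.map_mul,
          Perm.mul_apply, ih, ← hlk]
        rcases hx : l (k : ZMod m) with ⟨a, _ | _⟩
        · have e : (mk [(a, false)] : FreeGroup α) = (of a)⁻¹ := by simp [of, inv_mk, invRev]
          rw [e, _root_.map_inv, Perm.inv_eq_iff_eq]
          exact (h1 _ _ _ (Or.inl ⟨hx, by simp⟩)).symm
        · exact h1 _ _ _ (Or.inr ⟨hx, by simp⟩)
    simpa using step 0 (Nat.zero_le _)
  · rintro hm2 a ⟨x, s⟩ h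
    have : Fact (1 < m) := ⟨by omega⟩
    rcases h2 _ _ _ _ _ h with ⟨-, h⟩ | ⟨-, h, -⟩
    · rcases hR _ _ _ h with ⟨-, h⟩ | ⟨-, h⟩ <;> simp at h
    · simp at h
  · rintro hm3 a b hab ⟨x, s⟩ h
    rcases e : ρ (of b) (x, s) with ⟨y, t⟩
    rw [_root_.map_mul, Perm.mul_apply, e] at h
    have h20 : (1 : ZMod m) + 1 ≠ 0 := by
      intro h0
      have : ((2 : ℕ) : ZMod m) = 0 := by rw [← h0]; norm_num
      rw [ZMod.natCast_eq_zero_iff] at this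
      exact absurd (Nat.le_of_dvd two_pos this) (by omega)
    rcases h2 _ _ _ _ _ e with ⟨rfl, hb⟩ | ⟨rfl, hb, -⟩ <;>
      rcases h2 _ _ _ _ _ h with ⟨e', ha⟩ | ⟨e', ha, ha'⟩
    · rcases hR _ _ _ hb with ⟨k1, k2⟩ | ⟨k1, k2⟩ <;> rcases hR _ _ _ ha with ⟨k3, k4⟩ | ⟨k3, k4⟩
      · rw [k2, add_assoc] at k4; exact h20 (by simpa using k4)
      · exact hab (k3.symm.trans k1)
      · exact hab (k3.symm.trans k1)
      · rw [k2, add_assoc] at k4; exact h20 (by simpa using k4)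
    · simp at ha
    · simp [e'] at hb
    · simp [ha' b hab.symm] at hb

theorem exists_isCyclicallyReduced_isConj (u : FreeGroup α) :
    ∃ L, IsCyclicallyReduced L ∧ IsConj (mk L) u := by
  classical
  refine ⟨_, reduceCyclically.isCyclicallyReduced (isReduced_toWord (x := u)), isConj_iff.2
    ⟨mk (reduceCyclically.conjugator u.toWord), ?_⟩⟩
  rw [inv_mk, mul_mk, mul_mk, reduceCyclically.conj_conjugator_reduceCyclically, mk_toWord]

/-- An element conjugate to a generator in every finite quotient is conjugate to it. -/
theorem isConj_of_of_isFinitelyConj [Finite α] {u : FreeGroup α} {a : α}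
    (h : IsFinitelyConj u (of a)) : IsConj u (of a) := by
  classical
  obtain ⟨L, hL, hLu⟩ := exists_isCyclicallyReduced_isConj u
  have h' := (IsFinitelyConj.of_isConj hLu).trans h
  suffices mk L = of a from this ▸ hLu.symm
  let χ : FreeGroup α →* Multiplicative (ZMod 3) :=
    lift fun c => if c = a then Multiplicative.ofAdd 1 else 1
  have hχ : χ (mk L) = Multiplicative.ofAdd 1 := by
    rw [isConj_iff_eq.1 (h'.map_of_finite χ)]; simp [χ]
  match L, hL, h', hχ with
  | [], _, _, hχ => exact absurd hχ (by rw [← one_eq_mk, _root_.map_one]; decide)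
  | [(c, e)], _, _, hχ =>
    by_cases hc : c = a
    · subst hc
      cases e
      · exact absurd hχ (by simp [χ]; decide)
      · rfl
    · exact absurd hχ (by cases e <;> simp [χ, hc] <;> decide)
  | x :: y :: L, hL, h', _ =>
    obtain ⟨Y, _, ρ, hfix, hne, -⟩ := hL.exists_perm_rep (List.cons_ne_nil _ _)
    obtain ⟨y, hy⟩ := h'.exists_fixed_point ρ hfix
    exact absurd hy (hne (by simp) a y)

theorem mk_singleton_eq_zpow (x : α × Bool) : ∃ k : ℤ, mk [x] = of x.1 ^ k := by
  rcases x with ⟨a, _ | _⟩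
  · exact ⟨-1, by simp [of, inv_mk, invRev]⟩
  · exact ⟨1, by simp [of]⟩

theorem isCyclicallyReduced_cons_toWord_append_invRev [DecidableEq α] {a b : α}
    {w : FreeGroup α} (hw : w.toWord ≠ []) (ha : ∀ x ∈ w.toWord.head?, x.1 ≠ a)
    (hb : ∀ x ∈ w.toWord.getLast?, x.1 ≠ b) :
    IsCyclicallyReduced ((a, true) :: (w.toWord ++ (b, true) :: invRev w.toWord)) := by
  have hr := isReduced_toWord (x := w)
  have hr' := isReduced_toWord (x := w⁻¹)
  rw [toWord_inv] at hr'
  obtain ⟨x, hx⟩ : ∃ x, w.toWord.head? = some x := by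
    rw [← Option.isSome_iff_exists]; simpa using hw
  obtain ⟨y, hy⟩ : ∃ x, w.toWord.getLast? = some x := by
    rw [← Option.isSome_iff_exists]; simpa using hw
  have hx' : (invRev w.toWord).getLast? = some (x.1, !x.2) := by simp [invRev, hx]
  have hy' : (invRev w.toWord).head? = some (y.1, !y.2) := by simp [invRev, hy]
  have hxa := ha x hx
  have hyb := hb y hy
  constructor
  · rw [IsReduced, List.isChain_cons, List.isChain_append, List.isChain_cons]
    refine ⟨?_, hr, ⟨?_, hr'⟩, ?_⟩
    · simp [List.head?_append, hx, hxa.symm]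
    · simp [hy', hyb.symm]
    · simp [hy, hyb]
  · have : ((a, true) :: (w.toWord ++ (b, true) :: invRev w.toWord)).getLast? =
        some (x.1, !x.2) := by
      rw [← List.cons_append, List.getLast?_append, List.getLast?_cons]
      simp [hx']
    rw [this]
    simp [hxa]

/-- If `a * w * b * w⁻¹` is conjugate to `a * b` in every finite quotient, for distinct generators
`a` and `b`, then `w` lies in the double coset `⟨a⟩⟨b⟩`. -/
theorem exists_eq_zpow_mul_zpow [Finite α] {a b : α} (hab : a ≠ b) (w : FreeGroup α)
    (h : IsFinitelyConj (of a * (w * of b * w⁻¹)) (of a * of b)) :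
    ∃ k l : ℤ, w = of a ^ k * of b ^ l := by
  classical
  obtain ⟨n, hn⟩ : ∃ n, n = w.toWord.length := ⟨_, rfl⟩
  induction n using Nat.strong_induction_on generalizing w with
  | _ n ih =>
  subst hn
  have hr := isReduced_toWord (x := w)
  by_cases hw : w.toWord = []
  · exact ⟨0, 0, by simpa using toWord_eq_nil_iff.1 hw⟩
  by_cases ha : ∀ x ∈ w.toWord.head?, x.1 ≠ a
  · by_cases hb : ∀ x ∈ w.toWord.getLast?, x.1 ≠ b
    · exfalso
      have hc := isCyclicallyReduced_cons_toWord_append_invRev hw ha hb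
      have he : mk ((a, true) :: (w.toWord ++ (b, true) :: invRev w.toWord)) =
          of a * (w * of b * w⁻¹) := by
        conv_rhs => rw [← mk_toWord (x := w)]
        simp [of, inv_mk, mul_mk]
      obtain ⟨Y, _, ρ, hfix, -, hne⟩ := hc.exists_perm_rep (List.cons_ne_nil _ _)
      rw [he] at hfix
      obtain ⟨y, hy⟩ := h.exists_fixed_point ρ hfix
      refine hne ?_ a b hab y hy
      have := List.length_pos_iff.2 hw
      simp only [List.length_cons, List.length_append]
      omega
    · push Not at hb
      obtain ⟨x, hx, rfl⟩ := hb
      obtain ⟨W, hW⟩ := List.getLast?_eq_some_iff.1 hx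
      obtain ⟨j, hj⟩ := mk_singleton_eq_zpow x
      have hw' : w = mk W * of x.1 ^ j := by rw [← hj, mul_mk, ← hW, mk_toWord]
      have hWr : (mk W).toWord = W := by
        rw [toWord_mk]; exact IsReduced.reduce_eq (List.isChain_append.1 (hW ▸ hr)).1
      obtain ⟨k, l, hkl⟩ := ih W.length (by simp [hW]) (mk W) (by
        convert h using 2; rw [hw']; group) (by rw [hWr])
      exact ⟨k, l + j, by rw [hw', hkl, zpow_add, mul_assoc]⟩
  · push Not at ha
    obtain ⟨x, hx, rfl⟩ := ha
    obtain ⟨W, hW⟩ := List.head?_eq_some_iff.1 hx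
    obtain ⟨j, hj⟩ := mk_singleton_eq_zpow x
    have hw' : w = of x.1 ^ j * mk W := by
      rw [← hj, mul_mk, List.singleton_append, ← hW, mk_toWord]
    have hWr : (mk W).toWord = W := by
      rw [toWord_mk]; exact IsReduced.reduce_eq (List.isChain_cons.1 (hW ▸ hr)).2
    obtain ⟨k, l, hkl⟩ := ih W.length (by simp [hW]) (mk W) (by
      refine (IsFinitelyConj.of_isConj (isConj_iff.2 ⟨of x.1 ^ j, ?_⟩)).trans h
      rw [hw']; group) (by rw [hWr])
    exact ⟨j + k, l, by rw [hw', hkl, zpow_add, mul_assoc]⟩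

/-- An endomorphism of a free group of finite rank at least two which preserves the conjugacy class
of every element in every finite quotient is inner. -/
theorem exists_eq_conj_of_isFinitelyConj [Finite α] {a b : α} (hab : a ≠ b)
    (φ : FreeGroup α →* FreeGroup α) (hφ : ∀ x, IsFinitelyConj (φ x) x) :
    ∃ g, ∀ x, φ x = g * x * g⁻¹ := by
  classical
  have hgen : ∀ c, ∃ g, φ (of c) = g * of c * g⁻¹ := fun c => by
    obtain ⟨g, hg⟩ := isConj_iff.1 (isConj_of_of_isFinitelyConj (hφ (of c))).symm
    exact ⟨g, hg.symm⟩
  have hpair : ∀ g w c d, c ≠ d → φ (of c) = g * of c * g⁻¹ →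
      φ (of d) = (g * w) * of d * (g * w)⁻¹ → ∃ k l : ℤ, w = of c ^ k * of d ^ l := by
    intro g w c d hcd hc hd
    refine exists_eq_zpow_mul_zpow hcd w
      ((IsFinitelyConj.of_isConj (isConj_iff.2 ⟨g, ?_⟩)).trans (hφ (of c * of d)))
    rw [_root_.map_mul, hc, hd]; group
  obtain ⟨g₀, hg₀⟩ := hgen a
  obtain ⟨g₁, hg₁⟩ := hgen b
  obtain ⟨k, l, hkl⟩ := hpair g₀ (g₀⁻¹ * g₁) a b hab hg₀ (by rw [hg₁]; group)
  obtain ⟨g, hg⟩ : ∃ g, g = g₀ * of a ^ k := ⟨_, rfl⟩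
  have ha : φ (of a) = g * of a * g⁻¹ := by rw [hg₀, hg]; group
  have hb : φ (of b) = g * of b * g⁻¹ := by
    have : g₁ = g * of b ^ l := by rw [hg, mul_assoc, ← hkl]; group
    rw [hg₁, this]; group
  refine ⟨g, fun x => ?_⟩
  suffices φ = (MulAut.conj g).toMonoidHom by rw [this]; rfl
  ext c
  change φ (of c) = g * of c * g⁻¹
  by_cases hca : c = a
  · rw [hca, ha]
  by_cases hcb : c = b
  · rw [hcb, hb]
  obtain ⟨w, hw⟩ := hgen c
  have hw' : φ (of c) = (g * (g⁻¹ * w)) * of c * (g * (g⁻¹ * w))⁻¹ := by rw [hw]; group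
  obtain ⟨i, j, hij⟩ := hpair g _ a c (Ne.symm hca) ha hw'
  obtain ⟨i', j', hij'⟩ := hpair g _ b c (Ne.symm hcb) hb hw'
  have hi : i = 0 := by
    let χ : FreeGroup α →* Multiplicative ℤ :=
      lift fun c => if c = a then Multiplicative.ofAdd 1 else 1
    have e := congrArg χ (hij.symm.trans hij')
    simpa [χ, hca, hab.symm, ← ofAdd_zsmul] using e
  rw [hw', hij, hi]; group

end FreeGroup

/-- If `F` is a finitely generated free group of rank at least 2 and `φ ∈ Aut(F)`
induces an inner automorphism of the profinite completion `F̂`, then `φ` is inner;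
i.e. `Out(F) → Out(F̂)` is injective. -/
theorem stmt_10 (α : Type*) [Finite α] (h2 : ∃ a b : α, a ≠ b)
    (φ : MulAut (FreeGroup α))
    (h : ∃ gh : profComp (FreeGroup α), ∀ x : FreeGroup α,
        iotaHom (FreeGroup α) (φ x) = gh * iotaHom (FreeGroup α) x * gh⁻¹) :
    ∃ g : FreeGroup α, ∀ x : FreeGroup α, φ x = g * x * g⁻¹ := by
  obtain ⟨a, b, hab⟩ := h2
  obtain ⟨gh, hgh⟩ := h
  refine FreeGroup.exists_eq_conj_of_isFinitelyConj hab φ.toMonoidHom fun x N => ?_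
  exact (isConj_iff.2 ⟨gh.val N, (congrArg (fun y => y.val N) (hgh x)).symm⟩).symm
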